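/- Let φ = p̃/p be a bidegree (m,n) rational inner function on 𝔻², let α ∈ 𝕋, and suppose the vertical line {ζ ∈ 𝕋² : ζ₁ = τ} is contained in C_α(φ). If (τ, γ) ∈ 𝕋² is the limit of a sequence of points (τ_k, γ_k) ∈ C_α(φ) with τ_k ≠ τ for all k, then φ has a singularity at (τ, γ), i.e. p(τ, γ) = p̃(τ, γ) = 0. -/

import Mathlib

open MeasureTheory Complex Filter Topology

noncomputable section

/-- The open unit bidisk `𝔻²` in `ℂ²`. -/
def bidisk : Set (ℂ × ℂ) := {z | ‖z.1‖ < 1 ∧ ‖z.2‖ < 1}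

/-- The closed bidisk. -/
def closedBidisk : Set (ℂ × ℂ) := {z | ‖z.1‖ ≤ 1 ∧ ‖z.2‖ ≤ 1}

/-- The distinguished boundary `𝕋²` of the bidisk. -/
def torus2 : Set (ℂ × ℂ) := {z | ‖z.1‖ = 1 ∧ ‖z.2‖ = 1}

/-- Evaluation of a two-variable polynomial at a point of `ℂ²`. -/
def ev (p : MvPolynomial (Fin 2) ℂ) (z : ℂ × ℂ) : ℂ :=
  MvPolynomial.eval ![z.1, z.2] p

/-- The rational function `φ = p̃/p`. -/
def rif (p pt : MvPolynomial (Fin 2) ℂ) (z : ℂ × ℂ) : ℂ := ev pt z / ev p z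

/-- The partial derivative `∂φ/∂z₁` of `φ = p̃/p`, via the quotient rule. -/
def dphi1 (p pt : MvPolynomial (Fin 2) ℂ) (z : ℂ × ℂ) : ℂ :=
  (ev (MvPolynomial.pderiv 0 pt) z * ev p z - ev pt z * ev (MvPolynomial.pderiv 0 p) z) /
    (ev p z) ^ 2

/-- The partial derivative `∂φ/∂z₂` of `φ = p̃/p`, via the quotient rule. -/
def dphi2 (p pt : MvPolynomial (Fin 2) ℂ) (z : ℂ × ℂ) : ℂ :=
  (ev (MvPolynomial.pderiv 1 pt) z * ev p z - ev pt z * ev (MvPolynomial.pderiv 1 p) z) /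
    (ev p z) ^ 2

/-- `pt` is the reflection `p̃(z₁,z₂) = z₁^m z₂^n conj(p(1/conj z₁, 1/conj z₂))` of `p`
at bidegree `(m,n)`. -/
def IsReflection2 (m n : ℕ) (p pt : MvPolynomial (Fin 2) ℂ) : Prop :=
  ∀ z : ℂ × ℂ, z.1 ≠ 0 → z.2 ≠ 0 →
    ev pt z = z.1 ^ m * z.2 ^ n *
      (starRingEnd ℂ) (ev p (((starRingEnd ℂ) z.1)⁻¹, ((starRingEnd ℂ) z.2)⁻¹))

/-- The data of a bidegree `(m,n)` rational inner function `φ = p̃/p` on the bidisk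
(with `m, n ≥ 1`):  `p` has degree `m` in `z₁` and `n` in `z₂`, is zero-free on `𝔻²`,
and has no common factor with its reflection `p̃`. -/
structure IsRIF2 (m n : ℕ) (p pt : MvPolynomial (Fin 2) ℂ) : Prop where
  hm : 1 ≤ m
  hn : 1 ≤ n
  deg1 : MvPolynomial.degreeOf 0 p = m
  deg2 : MvPolynomial.degreeOf 1 p = n
  stable : ∀ z ∈ bidisk, ev p z ≠ 0
  coprime : ∀ r : MvPolynomial (Fin 2) ℂ, r ∣ p → r ∣ pt → IsUnit r
  reflection : IsReflection2 m n p pt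

/-- The unimodular level set `C_α(φ)`, the closure of the set of points of `𝕋²` where
the radial limit of `φ` equals `α`. -/
def levelSet2 (p pt : MvPolynomial (Fin 2) ℂ) (α : ℂ) : Set (ℂ × ℂ) :=
  closure {ζ | ζ ∈ torus2 ∧
    Tendsto (fun r : ℝ => rif p pt ((r : ℂ) * ζ.1, (r : ℂ) * ζ.2))
      (𝓝[<] (1 : ℝ)) (𝓝 α)}

/-- `α` is an exceptional value for `φ = p̃/p`: some horizontal or vertical line of `𝕋²`
is contained in `C_α(φ)`. -/
def IsExceptional (p pt : MvPolynomial (Fin 2) ℂ) (α : ℂ) : Prop :=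
  ∃ τ : ℂ, ‖τ‖ = 1 ∧
    ({ζ : ℂ × ℂ | ζ.1 = τ ∧ ‖ζ.2‖ = 1} ⊆ levelSet2 p pt α ∨
     {ζ : ℂ × ℂ | ‖ζ.1‖ = 1 ∧ ζ.2 = τ} ⊆ levelSet2 p pt α)

/-- `α` is a generic value for `φ = p̃/p`. -/
def IsGenericValue (p pt : MvPolynomial (Fin 2) ℂ) (α : ℂ) : Prop :=
  ¬ IsExceptional p pt α

/-- Normalized Lebesgue (arclength) measure on the unit circle, as a measure on `ℂ`. -/
def mCircle : Measure ℂ :=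
  (ENNReal.ofReal (2 * Real.pi))⁻¹ •
    Measure.map (fun θ : ℝ => Complex.exp ((θ : ℂ) * Complex.I))
      (MeasureTheory.volume.restrict (Set.Ico 0 (2 * Real.pi)))

/-- The two-variable product Poisson kernel. -/
def poisson2 (z ζ : ℂ × ℂ) : ℝ :=
  ((1 - ‖z.1‖ ^ 2) / ‖ζ.1 - z.1‖ ^ 2) * ((1 - ‖z.2‖ ^ 2) / ‖ζ.2 - z.2‖ ^ 2)

/-- `σ` is the Clark measure of `φ = p̃/p` at parameter `α`: a positive Borel measure
on `𝕋²` whose Poisson integral is `(1-|φ(z)|²)/|α-φ(z)|²`. -/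
def IsClarkMeasure2 (p pt : MvPolynomial (Fin 2) ℂ) (α : ℂ) (σ : Measure (ℂ × ℂ)) : Prop :=
  σ torus2ᶜ = 0 ∧
  ∀ z ∈ bidisk,
    ∫⁻ ζ, ENNReal.ofReal (poisson2 z ζ) ∂σ =
      ENNReal.ofReal ((1 - ‖rif p pt z‖ ^ 2) / ‖α - rif p pt z‖ ^ 2)

/-- `g₁, …, g_n : 𝕋 → 𝕋` are functions on the circle, analytic except possibly at one
base point `τ₀ ∈ 𝕋`. -/
def IsGraphFamily (n : ℕ) (g : Fin n → ℂ → ℂ) : Prop :=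
  (∀ j, ∀ ζ : ℂ, ‖ζ‖ = 1 → ‖g j ζ‖ = 1) ∧
  ∃ τ₀ : ℂ, ‖τ₀‖ = 1 ∧ ∀ j, ∀ θ : ℝ,
    Complex.exp ((θ : ℂ) * Complex.I) ≠ τ₀ →
      AnalyticAt ℝ (fun t : ℝ => g j (Complex.exp ((t : ℂ) * Complex.I))) θ

/-- The union of the graphs `{(ζ, g_j(ζ)) : ζ ∈ 𝕋}`. -/
def graphUnion (n : ℕ) (g : Fin n → ℂ → ℂ) : Set (ℂ × ℂ) :=
  ⋃ j, {w : ℂ × ℂ | ‖w.1‖ = 1 ∧ w.2 = g j w.1}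

/-- The vertical line `{ζ ∈ 𝕋² : ζ₁ = τ}`. -/
def vLine (τ : ℂ) : Set (ℂ × ℂ) := {w : ℂ × ℂ | w.1 = τ ∧ ‖w.2‖ = 1}

open Polynomial in
lemma aux_re (a : ℂ) (h : 1 ≤ ‖a‖) (h1 : a ≠ 1) :
    (1 / (1 - a)).re ≤ 1 / 2 ∧ (1 / 2 ≤ (1 / (1 - a)).re → ‖a‖ = 1) := by
  have hpos : 0 < Complex.normSq (1 - a) := Complex.normSq_pos.mpr (sub_ne_zero.mpr h1.symm)
  have hre : (1 / (1 - a)).re = (1 - a.re) / Complex.normSq (1 - a) := by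
    simp [Complex.inv_re]
  have hn : Complex.normSq (1 - a) = 1 - 2 * a.re + ‖a‖ ^ 2 := by
    rw [← Complex.normSq_eq_norm_sq, Complex.normSq_apply, Complex.normSq_apply]
    simp; ring
  rw [hre]
  constructor
  · rw [div_le_iff₀ hpos, hn]; nlinarith
  · intro h2
    rw [le_div_iff₀ hpos, hn] at h2
    nlinarith

lemma aux_sum (s : Multiset ℂ) : (∀ a ∈ s, 1 ≤ ‖a‖ ∧ a ≠ 1) →
    ((s.map fun a => 1 / (1 - a)).sum.re ≤ (s.card : ℝ) / 2 ∧
      ((s.card : ℝ) / 2 ≤ (s.map fun a => 1 / (1 - a)).sum.re → ∀ a ∈ s, ‖a‖ = 1)) := by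
  induction s using Multiset.induction with
  | empty => simp
  | cons a s ih =>
    intro h
    obtain ⟨i1, i2⟩ := ih fun b hb => h b (Multiset.mem_cons_of_mem hb)
    obtain ⟨ha, ha'⟩ := h a (Multiset.mem_cons_self a s)
    obtain ⟨j1, j2⟩ := aux_re a ha ha'
    rw [Multiset.map_cons, Multiset.sum_cons, Multiset.card_cons, Complex.add_re]
    push_cast
    refine ⟨by linarith, fun hh b hb => ?_⟩
    rcases Multiset.mem_cons.mp hb with rfl | hb
    · exact j2 (by linarith)
    · exact i2 (by linarith) b hb

lemma aux_prod (s : Multiset ℂ) : (∀ a ∈ s, 1 ≤ ‖a‖) →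
    (1 ≤ ‖(s.map fun a => 0 - a).prod‖ ∧
      (‖(s.map fun a => 0 - a).prod‖ ≤ 1 → ∀ a ∈ s, ‖a‖ = 1)) := by
  induction s using Multiset.induction with
  | empty => simp
  | cons a s ih =>
    intro h
    obtain ⟨i1, i2⟩ := ih fun b hb => h b (Multiset.mem_cons_of_mem hb)
    have ha := h a (Multiset.mem_cons_self a s)
    rw [Multiset.map_cons, Multiset.prod_cons, norm_mul, zero_sub, norm_neg]
    refine ⟨by nlinarith, fun hh b hb => ?_⟩
    rcases Multiset.mem_cons.mp hb with rfl | hb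
    · nlinarith
    · exact i2 (by nlinarith) b hb

lemma aux_one (s : Multiset ℂ) : (∀ a ∈ s, ‖a‖ = 1) → ‖(s.map fun a => 0 - a).prod‖ = 1 := by
  induction s using Multiset.induction with
  | empty => simp
  | cons a s ih =>
    intro h
    rw [Multiset.map_cons, Multiset.prod_cons, norm_mul, zero_sub, norm_neg,
      h a (Multiset.mem_cons_self a s), ih fun b hb => h b (Multiset.mem_cons_of_mem hb), one_mul]

lemma aux_conj (s : Multiset ℂ) : (∀ a ∈ s, ‖a‖ = 1) →
    (starRingEnd ℂ) (s.map fun a => 1 - a).prod * (s.map fun a => 0 - a).prod =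
      (s.map fun a => 1 - a).prod := by
  induction s using Multiset.induction with
  | empty => simp
  | cons a s ih =>
    intro h
    have i := ih fun b hb => h b (Multiset.mem_cons_of_mem hb)
    have ha := h a (Multiset.mem_cons_self a s)
    have haa : (starRingEnd ℂ) a * a = 1 := by
      rw [mul_comm, Complex.mul_conj, Complex.normSq_eq_norm_sq, ha]; simp
    simp only [Multiset.map_cons, Multiset.prod_cons, map_mul, map_sub, map_one]
    calc _ = ((starRingEnd ℂ) a * a - a) *
          ((starRingEnd ℂ) (s.map fun a => 1 - a).prod * (s.map fun a => 0 - a).prod) := by ring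
      _ = _ := by rw [i, haa]

/-- one-variable reflection -/
def OneRefl (N : ℕ) (u : ℂ) (q qt : Polynomial ℂ) : Prop :=
  ∀ ζ : ℂ, ζ ≠ 0 → qt.eval ζ = u * ζ ^ N * (starRingEnd ℂ) (q.eval ((starRingEnd ℂ) ζ)⁻¹)

lemma OneRefl.eval_zero {N : ℕ} {u : ℂ} {q qt : Polynomial ℂ} (h : OneRefl N u q qt)
    (hd : q.natDegree ≤ N) : qt.eval 0 = u * (starRingEnd ℂ) (q.coeff N) := by
  have key : qt = Polynomial.C u * (q.map (starRingEnd ℂ)).reflect N := by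
    apply Polynomial.eq_of_infinite_eval_eq
    refine Set.Infinite.mono (s := {0}ᶜ) ?_ (Set.finite_singleton (0 : ℂ)).infinite_compl
    intro ζ hζ
    have hζ : ζ ≠ 0 := hζ
    have hz : ζ⁻¹ ≠ 0 := inv_ne_zero hζ
    let _ := invertibleOfNonzero hz
    have e := Polynomial.eval₂_reflect_mul_pow (RingHom.id ℂ) (ζ⁻¹) N
      (q.map (starRingEnd ℂ)) (by simpa using hd)
    simp only [invOf_eq_inv, inv_inv, Polynomial.eval₂_id] at e
    have e2 : Polynomial.eval ζ⁻¹ (q.map (starRingEnd ℂ)) =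
        (starRingEnd ℂ) (q.eval ((starRingEnd ℂ) ζ)⁻¹) := by
      have := Polynomial.eval_map_apply (f := starRingEnd ℂ) (p := q) (((starRingEnd ℂ) ζ)⁻¹)
      simpa using this
    show qt.eval ζ = _
    rw [h ζ hζ, ← e2, ← e, Polynomial.eval_mul, Polynomial.eval_C, inv_pow]
    field_simp
  rw [key, ← Polynomial.coeff_zero_eq_eval_zero, Polynomial.coeff_C_mul, Polynomial.coeff_reflect]
  rw [Polynomial.revAt_le (Nat.zero_le N), Nat.sub_zero, Polynomial.coeff_map]

lemma OneRefl.deriv {N : ℕ} {u : ℂ} {q qt : Polynomial ℂ} (h : OneRefl N u q qt) :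
    qt.derivative.eval 1 = u * (N * (starRingEnd ℂ) (q.eval 1)
      - (starRingEnd ℂ) (q.derivative.eval 1)) := by
  have h1 : HasDerivAt (fun t : ℝ => qt.eval (t : ℂ)) (qt.derivative.eval 1) 1 := by
    have := (qt.hasDerivAt ((1 : ℝ) : ℂ)).comp_ofReal
    simpa using this
  have h2 : HasDerivAt (fun ζ : ℂ => q.eval ζ⁻¹) (-q.derivative.eval 1) ((1 : ℝ) : ℂ) := by
    have hi : HasDerivAt (fun ζ : ℂ => ζ⁻¹) (-1) ((1 : ℝ) : ℂ) := by
      simpa using hasDerivAt_inv (x := (1 : ℂ)) one_ne_zero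
    have hq : HasDerivAt (fun ζ : ℂ => q.eval ζ) (q.derivative.eval 1) (((1 : ℝ) : ℂ)⁻¹) := by
      simpa using q.hasDerivAt (1 : ℂ)
    have hh := hq.comp ((1 : ℝ) : ℂ) hi
    rw [mul_neg_one] at hh
    exact hh
  have h3 := h2.comp_ofReal.star
  have h4 : HasDerivAt (fun t : ℝ => u * (t : ℂ) ^ N) (u * N) 1 := by
    have := ((hasDerivAt_pow N ((1 : ℝ) : ℂ)).const_mul u).comp_ofReal
    simpa using this
  have h5 := h4.mul h3
  have h6 : HasDerivAt (fun t : ℝ => qt.eval (t : ℂ))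
      (u * N * star (q.eval 1) + u * star (-q.derivative.eval 1)) 1 := by
    have h7 : (fun t : ℝ => qt.eval (t : ℂ)) =ᶠ[𝓝 1]
        ((fun t : ℝ => u * (t : ℂ) ^ N) * fun t : ℝ => star (q.eval (t : ℂ)⁻¹)) := by
      filter_upwards [lt_mem_nhds (zero_lt_one (α := ℝ))] with t ht
      have := h (t : ℂ) (by exact_mod_cast ht.ne')
      rw [this]
      simp
    refine HasDerivAt.congr_of_eventuallyEq ?_ h7
    simpa using h5
  rw [h1.unique h6]
  simp only [star_neg, starRingEnd_apply]
  ring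

/-- Step 1: a critical point forces `|qt 0| = |q 0|`. -/
lemma step1 {N : ℕ} {u α : ℂ} {q qt : Polynomial ℂ} (h : OneRefl N u q qt)
    (hd : q.natDegree ≤ N) (hu : ‖u‖ = 1)
    (hq : ∀ a, ‖a‖ < 1 → q.eval a ≠ 0) (hq1 : q.eval 1 ≠ 0)
    (e0 : qt.eval 1 = α * q.eval 1) (e1 : qt.derivative.eval 1 = α * q.derivative.eval 1)
    : ‖qt.eval 0‖ = ‖q.eval 0‖ := by
  have hsp := IsAlgClosed.splits q
  have hq0 : q ≠ 0 := by rintro rfl; simp at hq1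
  have r := h 1 one_ne_zero
  simp only [one_pow, mul_one, map_one, inv_one] at r
  have hd' := h.deriv
  set s := q.derivative.eval 1 / q.eval 1 with hs
  have hs' : q.derivative.eval 1 = s * q.eval 1 := by rw [hs]; field_simp
  have hu0 : u ≠ 0 := by intro h0; simp [h0] at hu
  have hc : (starRingEnd ℂ) (q.eval 1) ≠ 0 := by simpa using hq1
  have key : s = N - (starRingEnd ℂ) s := by
    rw [e1, hs', map_mul] at hd'
    have : u * (starRingEnd ℂ) (q.eval 1) * (s - (N - (starRingEnd ℂ) s)) = 0 := by
      have e2 : u * (starRingEnd ℂ) (q.eval 1) = α * q.eval 1 := by rw [← r, e0]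
      have e3 : α * (s * q.eval 1) = s * (u * (starRingEnd ℂ) (q.eval 1)) := by rw [e2]; ring
      rw [e3] at hd'
      linear_combination hd'
    rcases mul_eq_zero.mp this with h1 | h1
    · exact absurd h1 (mul_ne_zero hu0 hc)
    · exact sub_eq_zero.mp h1
  have hre : s.re = N / 2 := by
    have := congrArg Complex.re key
    simp at this
    linarith
  rw [hsp.eval_derivative_div_eval_of_ne_zero hq1] at hs
  have hroots : ∀ a ∈ q.roots, 1 ≤ ‖a‖ ∧ a ≠ 1 := by
    intro a ha
    have ha := (Polynomial.mem_roots hq0).mp ha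
    refine ⟨?_, ?_⟩
    · by_contra! hlt
      exact hq a hlt ha
    · rintro rfl
      exact hq1 ha
  obtain ⟨j1, j2⟩ := aux_sum q.roots hroots
  have hcard := hsp.natDegree_eq_card_roots
  rw [← hs, ← hcard, hre] at j1 j2
  have hdN : q.natDegree = N := by
    have : (N : ℝ) ≤ q.natDegree := by linarith
    exact le_antisymm hd (by exact_mod_cast this)
  have j3 := aux_one _ (j2 (by rw [hdN]))
  rw [h.eval_zero hd, hsp.eval_eq_prod_roots 0, norm_mul, norm_mul, hu, j3, ← hdN]
  simp

/-- Step 2: `|qt 0| = |q 0|` forces `qt = c q`. -/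
lemma step2 {N : ℕ} {u : ℂ} {q qt : Polynomial ℂ} (h : OneRefl N u q qt)
    (hd : q.natDegree ≤ N) (hu : ‖u‖ = 1)
    (hq : ∀ a, ‖a‖ < 1 → q.eval a ≠ 0)
    (e : ‖qt.eval 0‖ = ‖q.eval 0‖) : qt.eval 1 * q.eval 0 = q.eval 1 * qt.eval 0 := by
  have hsp := IsAlgClosed.splits q
  have h0 : q.eval 0 ≠ 0 := hq 0 (by simp)
  have hq0 : q ≠ 0 := by rintro rfl; simp at h0
  have r := h 1 one_ne_zero
  simp only [one_pow, mul_one, map_one, inv_one] at r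
  have z := h.eval_zero hd
  have hcN : q.coeff N ≠ 0 := by
    intro hc
    rw [z, hc] at e
    simp at e
    exact h0 (norm_eq_zero.mp e.symm)
  have hdN : q.natDegree = N := le_antisymm hd (Polynomial.le_natDegree_of_ne_zero hcN)
  have hl : q.coeff N = q.leadingCoeff := by rw [← hdN]; rfl
  have hl0 : q.leadingCoeff ≠ 0 := by simpa using hq0
  have p0 := hsp.eval_eq_prod_roots 0
  have p1 := hsp.eval_eq_prod_roots 1
  have hroots : ∀ a ∈ q.roots, 1 ≤ ‖a‖ := by
    intro a ha
    have ha := (Polynomial.mem_roots hq0).mp ha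
    by_contra! hlt
    exact hq a hlt ha
  have hone : ‖(q.roots.map fun a => 0 - a).prod‖ = 1 := by
    rw [z, p0, norm_mul, norm_mul, hu, hl, Complex.norm_conj, one_mul] at e
    have : ‖q.leadingCoeff‖ ≠ 0 := by simpa using hl0
    exact mul_left_cancel₀ this (by rw [← e, mul_one])
  have j := aux_conj _ ((aux_prod _ hroots).2 hone.le)
  rw [r, z, p0, p1, hl, map_mul]
  linear_combination (u * (starRingEnd ℂ) q.leadingCoeff * q.leadingCoeff) * j

/-- Restriction to a diagonal disc. -/
def diagP (τ γ : ℂ) (p : MvPolynomial (Fin 2) ℂ) : Polynomial ℂ :=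
  MvPolynomial.aeval ![Polynomial.C τ * Polynomial.X, Polynomial.C γ * Polynomial.X] p

lemma diagP_eval (τ γ : ℂ) (p : MvPolynomial (Fin 2) ℂ) (ζ : ℂ) :
    (diagP τ γ p).eval ζ = ev p (τ * ζ, γ * ζ) := by
  unfold diagP ev
  induction p using MvPolynomial.induction_on with
  | C a => simp
  | add p q hp hq => simp only [map_add, Polynomial.eval_add, hp, hq]
  | mul_X p i hp =>
    simp only [map_mul, Polynomial.eval_mul, hp]
    fin_cases i <;> simp

lemma diagP_natDegree (τ γ : ℂ) (p : MvPolynomial (Fin 2) ℂ) :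
    (diagP τ γ p).natDegree ≤ MvPolynomial.degreeOf 0 p + MvPolynomial.degreeOf 1 p := by
  unfold diagP
  rw [MvPolynomial.aeval_def, MvPolynomial.eval₂_eq']
  refine Polynomial.natDegree_sum_le_of_forall_le _ _ fun d hd => ?_
  have h0 := MvPolynomial.monomial_le_degreeOf 0 hd
  have h1 := MvPolynomial.monomial_le_degreeOf 1 hd
  have : (algebraMap ℂ (Polynomial ℂ)) (MvPolynomial.coeff d p) *
      ∏ i, (![Polynomial.C τ * Polynomial.X, Polynomial.C γ * Polynomial.X] :
        Fin 2 → Polynomial ℂ) i ^ d i =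
      Polynomial.C (MvPolynomial.coeff d p * τ ^ d 0 * γ ^ d 1) *
        Polynomial.X ^ (d 0 + d 1) := by
    simp [Fin.prod_univ_two, mul_pow, pow_add]
    ring
  rw [this]
  exact (Polynomial.natDegree_C_mul_X_pow_le _ _).trans (by omega)

lemma diagP_refl {m n : ℕ} {p pt : MvPolynomial (Fin 2) ℂ} (h : IsReflection2 m n p pt)
    {τ γ : ℂ} (hτ : ‖τ‖ = 1) (hγ : ‖γ‖ = 1) :
    OneRefl (m + n) (τ ^ m * γ ^ n) (diagP τ γ p) (diagP τ γ pt) := by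
  intro ζ hζ
  have t0 : τ ≠ 0 := by rintro rfl; simp at hτ
  have g0 : γ ≠ 0 := by rintro rfl; simp at hγ
  have inv : ∀ x : ℂ, ‖x‖ = 1 → ((starRingEnd ℂ) x)⁻¹ = x := by
    intro x hx
    rw [← Complex.inv_eq_conj hx, inv_inv]
  rw [diagP_eval, diagP_eval, h _ (mul_ne_zero t0 hζ) (mul_ne_zero g0 hζ)]
  simp only [map_mul, mul_inv, inv τ hτ, inv γ hγ]
  ring

lemma ev_continuous (p : MvPolynomial (Fin 2) ℂ) : Continuous (ev p) := by
  unfold ev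
  have : Continuous fun z : ℂ × ℂ => (![z.1, z.2] : Fin 2 → ℂ) := by
    refine continuous_pi fun i => ?_
    fin_cases i
    · exact continuous_fst
    · exact continuous_snd
  exact (MvPolynomial.continuous_eval p).comp this

lemma levelSet2_eq {p pt : MvPolynomial (Fin 2) ℂ} (hst : ∀ z ∈ bidisk, ev p z ≠ 0) {α : ℂ}
    {z : ℂ × ℂ} (hz : z ∈ levelSet2 p pt α) : ev pt z = α * ev p z := by
  have hcl : IsClosed {z : ℂ × ℂ | ev pt z = α * ev p z} :=
    isClosed_eq (ev_continuous pt) (continuous_const.mul (ev_continuous p))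
  refine closure_minimal ?_ hcl hz
  rintro ζ ⟨⟨h1, h2⟩, ht⟩
  have hc : Continuous fun r : ℝ => ((r : ℂ) * ζ.1, (r : ℂ) * ζ.2) := by fun_prop
  have lim : ∀ f : MvPolynomial (Fin 2) ℂ,
      Tendsto (fun r : ℝ => ev f ((r : ℂ) * ζ.1, (r : ℂ) * ζ.2)) (𝓝[<] (1 : ℝ)) (𝓝 (ev f ζ)) := by
    intro f
    have := ((ev_continuous f).comp hc).tendsto 1
    simp at this
    exact this.mono_left nhdsWithin_le_nhds
  refine tendsto_nhds_unique (lim pt) ((ht.mul (lim p)).congr' ?_)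
  have hev : ∀ᶠ r : ℝ in 𝓝[<] (1 : ℝ), r ∈ Set.Ioo (0 : ℝ) 1 := Ioo_mem_nhdsLT one_pos
  filter_upwards [hev] with r hr
  have hb : ((r : ℂ) * ζ.1, (r : ℂ) * ζ.2) ∈ bidisk := by
    have : ‖(r : ℂ)‖ < 1 := by
      rw [Complex.norm_real, Real.norm_of_nonneg hr.1.le]; exact hr.2
    constructor <;> simp only [norm_mul, h1, h2, mul_one, this]
  unfold rif
  exact div_mul_cancel₀ _ (hst _ hb)

lemma circle_infinite : {z : ℂ | ‖z‖ = 1}.Infinite := by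
  have h : Function.Injective (fun n : ℕ => Complex.exp ((n : ℂ) * Complex.I)) := by
    intro a b hab
    obtain ⟨k, hk⟩ := Complex.exp_eq_exp_iff_exists_int.mp hab
    have e : (a : ℂ) = b + k * (2 * Real.pi) := by
      have := mul_right_cancel₀ (b := Complex.I) Complex.I_ne_zero
        (a := (a : ℂ)) (c := b + k * (2 * Real.pi)) (by rw [hk]; ring)
      exact this
    have e' : (a : ℝ) = b + k * (2 * Real.pi) := by exact_mod_cast e
    by_cases hk0 : k = 0
    · subst hk0; simpa using e'
    · exfalso
      apply irrational_pi
      refine ⟨((a : ℚ) - b) / (2 * k), ?_⟩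
      have : (k : ℝ) ≠ 0 := by exact_mod_cast hk0
      push_cast
      rw [e']
      field_simp
      ring
  refine (Set.infinite_range_of_injective h).mono ?_
  rintro _ ⟨n, rfl⟩
  simpa using Complex.norm_exp_ofReal_mul_I (n : ℝ)

lemma factor_line (P : MvPolynomial (Fin 2) ℂ) (τ : ℂ)
    (h : ∀ y : ℂ, ‖y‖ = 1 → ev P (τ, y) = 0) :
    ∃ Q : MvPolynomial (Fin 2) ℂ, P = (MvPolynomial.X 0 - MvPolynomial.C τ) * Q := by
  have hr : (MvPolynomial.finSuccEquiv ℂ 1 P).eval (MvPolynomial.C τ) = 0 := by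
    refine MvPolynomial.funext_set (fun _ => {z : ℂ | ‖z‖ = 1}) (fun _ => circle_infinite) ?_
    intro x hx
    have e := MvPolynomial.eval_eq_eval_mv_eval' x τ P
    have e2 := Polynomial.eval_map_apply (f := MvPolynomial.eval x)
      (p := MvPolynomial.finSuccEquiv ℂ 1 P) (MvPolynomial.C τ)
    rw [MvPolynomial.eval_C] at e2
    rw [map_zero, ← e2, ← e]
    have e3 := h (x 0) (hx 0 trivial)
    unfold ev at e3
    have e4 : (Fin.cons τ x : Fin 2 → ℂ) = ![τ, x 0] := by
      funext i
      fin_cases i <;> rfl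
    rw [e4]
    exact e3
  obtain ⟨R, hR⟩ := Polynomial.dvd_iff_isRoot.mpr hr
  refine ⟨(MvPolynomial.finSuccEquiv ℂ 1).symm R, ?_⟩
  apply (MvPolynomial.finSuccEquiv ℂ 1).injective
  rw [map_mul, AlgEquiv.apply_symm_apply, hR, map_sub, MvPolynomial.finSuccEquiv_X_zero]
  congr 2
  simp [MvPolynomial.finSuccEquiv_apply]

/-- Let `φ = p̃/p` be a bidegree `(m,n)` RIF on `𝔻²` and suppose the
vertical line `{ζ ∈ 𝕋² : ζ₁ = τ}` is contained in `C_α(φ)`. If `(τ, γ) ∈ 𝕋²` is the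
limit of a sequence of points `(τ_k, γ_k) ∈ C_α(φ)` with `τ_k ≠ τ`, then `φ` has a
singularity at `(τ, γ)`, i.e. `p(τ, γ) = p̃(τ, γ) = 0`. -/
theorem line_accumulation_is_singularity
    (m n : ℕ) (p pt : MvPolynomial (Fin 2) ℂ) (hRIF : IsRIF2 m n p pt)
    (α : ℂ) (hα : ‖α‖ = 1) (τ γ : ℂ) (hτ : ‖τ‖ = 1) (hγ : ‖γ‖ = 1)
    (hline : vLine τ ⊆ levelSet2 p pt α)
    (w : ℕ → ℂ × ℂ)
    (hwmem : ∀ k, w k ∈ levelSet2 p pt α)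
    (hwne : ∀ k, (w k).1 ≠ τ)
    (hwlim : Tendsto w atTop (𝓝 (τ, γ))) :
    ev p (τ, γ) = 0 ∧ ev pt (τ, γ) = 0 := by
  have hst := hRIF.stable
  have hP : ∀ z ∈ levelSet2 p pt α, ev pt z = α * ev p z := fun z hz => levelSet2_eq hst hz
  have hpt : ev pt (τ, γ) = α * ev p (τ, γ) := hP _ (hline ⟨rfl, hγ⟩)
  by_cases hp : ev p (τ, γ) = 0
  · exact ⟨hp, by rw [hpt, hp, mul_zero]⟩
  exfalso
  have evP : ∀ z, ev (pt - MvPolynomial.C α * p) z = ev pt z - α * ev p z := by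
    intro z; simp [ev]
  obtain ⟨Q, hQ⟩ := factor_line (pt - MvPolynomial.C α * p) τ (by
    intro y hy
    rw [evP, hP _ (hline ⟨rfl, hy⟩), sub_self])
  have evQ : ∀ z, ev pt z - α * ev p z = (z.1 - τ) * ev Q z := by
    intro z
    rw [← evP, hQ]; simp [ev]
  have hQ0 : ev Q (τ, γ) = 0 := by
    have l := ((ev_continuous Q).tendsto (τ, γ)).comp hwlim
    refine tendsto_nhds_unique l (tendsto_const_nhds.congr fun k => ?_)
    have e := evQ (w k)
    rw [hP _ (hwmem k), sub_self] at e
    exact ((mul_eq_zero.mp e.symm).resolve_left (sub_ne_zero.mpr (hwne k))).symm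
  have hF : diagP τ γ pt - Polynomial.C α * diagP τ γ p =
      (Polynomial.C τ * Polynomial.X - Polynomial.C τ) * diagP τ γ Q := by
    have := congrArg (diagP τ γ) hQ
    simpa [diagP] using this
  have dQ : (diagP τ γ Q).eval 1 = 0 := by rw [diagP_eval]; simpa using hQ0
  have dp : (diagP τ γ p).eval 1 = ev p (τ, γ) := by rw [diagP_eval]; simp
  have dpt : (diagP τ γ pt).eval 1 = ev pt (τ, γ) := by rw [diagP_eval]; simp
  have hder : (diagP τ γ pt).derivative.eval 1 = α * (diagP τ γ p).derivative.eval 1 := by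
    have := congrArg (fun f => (Polynomial.derivative f).eval 1) hF
    simp [dQ] at this
    exact sub_eq_zero.mp this
  have hun : ∀ a b : ℂ, ‖a‖ = 1 → ‖b‖ = 1 → ‖a ^ m * b ^ n‖ = 1 := by
    intro a b ha hb; simp [ha, hb]
  have hdeg : ∀ a b : ℂ, (diagP a b p).natDegree ≤ m + n := by
    intro a b
    have := diagP_natDegree a b p
    rwa [hRIF.deg1, hRIF.deg2] at this
  have hnz : ∀ a b : ℂ, ‖a‖ = 1 → ‖b‖ = 1 → ∀ ζ, ‖ζ‖ < 1 → (diagP a b p).eval ζ ≠ 0 := by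
    intro a b ha hb ζ hζ
    rw [diagP_eval]
    refine hst _ ?_
    constructor <;> simp only [norm_mul, ha, hb, one_mul, hζ]
  have s1 := step1 (diagP_refl hRIF.reflection hτ hγ) (hdeg τ γ) (hun _ _ hτ hγ)
    (hnz _ _ hτ hγ) (by rwa [dp]) (by rw [dp, dpt, hpt]) hder
  simp only [diagP_eval, mul_zero] at s1
  have hprop : MvPolynomial.C (ev p (0, 0)) * pt = MvPolynomial.C (ev pt (0, 0)) * p := by
    refine MvPolynomial.funext_set (fun _ => {z : ℂ | ‖z‖ = 1}) (fun _ => circle_infinite) ?_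
    intro x hx
    have h0 : ‖x 0‖ = 1 := hx 0 trivial
    have h1 : ‖x 1‖ = 1 := hx 1 trivial
    have s2 := step2 (diagP_refl hRIF.reflection h0 h1) (hdeg _ _) (hun _ _ h0 h1)
      (hnz _ _ h0 h1) (by simpa only [diagP_eval, mul_zero] using s1)
    simp only [diagP_eval, mul_zero, mul_one] at s2
    have hx' : (![x 0, x 1] : Fin 2 → ℂ) = x := by
      ext i; fin_cases i <;> rfl
    have ex : ∀ f, ev f (x 0, x 1) = MvPolynomial.eval x f := by
      intro f; simp only [ev, hx']
    rw [ex, ex] at s2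
    rw [map_mul, map_mul, MvPolynomial.eval_C, MvPolynomial.eval_C]
    linear_combination s2
  have hp0 : ev p (0, 0) ≠ 0 := hst _ (by constructor <;> simp)
  have hdvd : p ∣ pt := by
    refine ⟨MvPolynomial.C ((ev p (0, 0))⁻¹ * ev pt (0, 0)), ?_⟩
    rw [MvPolynomial.C_mul, mul_comm p, mul_assoc, ← hprop, ← mul_assoc, ← MvPolynomial.C_mul,
      inv_mul_cancel₀ hp0, MvPolynomial.C_1, one_mul]
  obtain ⟨c, -, hc⟩ := MvPolynomial.isUnit_iff_eq_C_of_isReduced.mp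
    (hRIF.coprime p dvd_rfl hdvd)
  have d1 := hRIF.deg1
  rw [hc, MvPolynomial.degreeOf_C] at d1
  have := hRIF.hm
  omega
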